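/- Let Ω_X and Ω_Y be compact metric spaces equipped with finite Borel measures μ and ν, and let f : Ω_X × Ω_Y → [0,∞) be a bounded Borel measurable function with ∫ f d(μ×ν) = 1. Define the marginal f_X(x) := ∫ f(x,y) dν(y), and suppose there is a constant M < ∞ with f(x,y) ≤ M · f_X(x) for all (x,y) (boundedness of the conditional density). Then for every ε > 0 there exist K ∈ ℕ, a measurable partition A_1, …, A_K of Ω_X, and measurable functions h_1, …, h_K : Ω_Y → (0,∞) with ∫ h_i dν = 1 for each i, such that ∫_{{(x,y) : f(x,y) > 0}} f(x,y) · log( f(x,y) / (f_X(x) · h(x,y)) ) d(μ×ν) < ε, where h(x,y) := h_i(y) for x ∈ A_i. -/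

import Mathlib

open MeasureTheory

lemma aux_approx {X Y : Type*}
    [MetricSpace X] [CompactSpace X] [MeasurableSpace X] [BorelSpace X]
    [MetricSpace Y] [CompactSpace Y] [MeasurableSpace Y] [BorelSpace Y] [Nonempty X]
    (μ : Measure X) (ν : Measure Y) [IsFiniteMeasure μ] [IsFiniteMeasure ν]
    (g : X × Y → ℝ) (hg : Integrable g (μ.prod ν)) (hg0 : ∀ p, 0 ≤ g p)
    (η : ℝ) (hη : 0 < η) :
    ∃ (K : ℕ) (ι : X → Fin K) (c : Fin K → X) (ψ : X × Y → ℝ),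
      Measurable ι ∧ Continuous ψ ∧ (∀ p, 0 ≤ ψ p) ∧
      ∫ p, |g p - ψ (c (ι p.1), p.2)| ∂(μ.prod ν) ≤ η := by
  have : SecondCountableTopology X := inferInstance
  have : SecondCountableTopology Y := inferInstance
  set T := (μ.prod ν).real Set.univ with hT
  have hT0 : 0 ≤ T := measureReal_nonneg
  obtain ⟨φ, hφ, hφi⟩ := hg.exists_boundedContinuous_integral_sub_le (half_pos hη)
  let ψ : X × Y → ℝ := fun p => max (φ p) 0
  have hψc : Continuous ψ := φ.continuous.max continuous_const
  have hu : UniformContinuous ψ := CompactSpace.uniformContinuous_of_continuous hψc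
  set r := η / (2 * (T + 1)) with hr
  have hr0 : 0 < r := by positivity
  obtain ⟨d, hd, hdd⟩ := Metric.uniformContinuous_iff.1 hu r hr0
  let e := TopologicalSpace.denseSeq X
  have hcov : (Set.univ : Set X) ⊆ ⋃ n, Metric.ball (e n) d := by
    intro x _
    obtain ⟨n, hn⟩ := (TopologicalSpace.denseRange_denseSeq X).exists_dist_lt x hd
    exact Set.mem_iUnion.2 ⟨n, hn⟩
  obtain ⟨t, ht⟩ := isCompact_univ.elim_finite_subcover _ (fun n => Metric.isOpen_ball) hcov
  let N := t.sup id
  have hle : ∀ x, SimpleFunc.nearestPtInd e N x < N + 1 := fun x =>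
    Nat.lt_succ_of_le (SimpleFunc.nearestPtInd_le e N x)
  let ι : X → Fin (N + 1) := fun x => ⟨SimpleFunc.nearestPtInd e N x, hle x⟩
  have hι : Measurable ι := by
    refine measurable_to_countable' fun i => ?_
    have : ι ⁻¹' {i} = SimpleFunc.nearestPtInd e N ⁻¹' {(i : ℕ)} := by
      ext x; simp [ι, Fin.ext_iff]
    rw [this]
    exact SimpleFunc.measurableSet_fiber _ _
  have hclose : ∀ x, dist x (e (ι x)) < d := by
    intro x
    have := ht (Set.mem_univ x)
    simp only [Set.mem_iUnion] at this
    obtain ⟨n, hn, hx⟩ := this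
    have h1 := SimpleFunc.edist_nearestPt_le e x (k := n) (N := N) (Finset.le_sup (f := id) hn)
    have h2 : dist (e (ι x)) x ≤ dist (e n) x := by
      rw [edist_dist, edist_dist] at h1
      exact (ENNReal.ofReal_le_ofReal_iff dist_nonneg).1 h1
    rw [dist_comm]
    rw [Metric.mem_ball, dist_comm] at hx
    exact h2.trans_lt hx
  refine ⟨N + 1, ι, fun i => e i, ψ, hι, hψc, fun p => le_max_right _ _, ?_⟩
  have hb : ∀ p : X × Y, |g p - ψ (e (ι p.1), p.2)| ≤ ‖g p - φ p‖ + r := by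
    intro p
    have h1 : |g p - ψ p| ≤ |g p - φ p| := by
      have := abs_max_sub_max_le_abs (g p) (φ p) 0
      rwa [max_eq_left (hg0 p)] at this
    have h2 : |ψ p - ψ (e (ι p.1), p.2)| < r := by
      have := hdd (a := p) (b := (e (ι p.1), p.2)) (by
        rw [Prod.dist_eq]; simpa [hd] using hclose p.1)
      rwa [Real.dist_eq] at this
    rw [Real.norm_eq_abs]
    have := abs_sub_le (g p) (ψ p) (ψ (e (ι p.1), p.2))
    linarith
  have hi : Integrable (fun p => ‖g p - φ p‖) (μ.prod ν) := (hg.sub hφi).norm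
  calc _ ≤ ∫ p, (‖g p - φ p‖ + r) ∂(μ.prod ν) :=
        integral_mono_of_nonneg (ae_of_all _ fun p => abs_nonneg _)
          (hi.add (integrable_const r)) (ae_of_all _ hb)
    _ = (∫ p, ‖g p - φ p‖ ∂(μ.prod ν)) + T * r := by
        rw [integral_add hi (integrable_const r), integral_const, smul_eq_mul]
    _ ≤ η / 2 + η / 2 := by
        gcongr
        rw [hr, ← mul_div_assoc, div_le_iff₀ (by positivity)]
        nlinarith
    _ = η := by ring

lemma aux_ptwise (f F k δ Z : ℝ) (hf : 0 < f) (hF : 0 < F) (hk : 0 ≤ k) (hδ : 0 < δ)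
    (hZ : 0 < Z) :
    f * Real.log (f / (F * ((k + δ) / Z))) ≤ f * (|f / F - k| / δ + (Z - 1)) := by
  have hg : 0 < f / F := by positivity
  have hkd : 0 < k + δ := by positivity
  have h0 : f / (F * ((k + δ) / Z)) = ((f / F) / (k + δ)) * Z := by field_simp
  rw [h0, Real.log_mul (by positivity) (by positivity)]
  have h1 := Real.log_le_sub_one_of_pos (x := (f / F) / (k + δ)) (by positivity)
  have h2 := Real.log_le_sub_one_of_pos hZ
  have h3 : (f / F) / (k + δ) - 1 ≤ |f / F - k| / δ := by
    rw [div_sub_one hkd.ne']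
    calc _ ≤ |f / F - k| / (k + δ) := by
          gcongr
          linarith [le_abs_self (f / F - k)]
      _ ≤ _ := by gcongr; linarith
  gcongr
  linarith

theorem stmt1 {X Y : Type*}
    [MetricSpace X] [CompactSpace X] [MeasurableSpace X] [BorelSpace X]
    [MetricSpace Y] [CompactSpace Y] [MeasurableSpace Y] [BorelSpace Y]
    (μ : Measure X) (ν : Measure Y) [IsFiniteMeasure μ] [IsFiniteMeasure ν]
    (f : X × Y → ℝ) (hf_meas : Measurable f) (hf_nonneg : ∀ p, 0 ≤ f p)
    (C : ℝ) (hf_bdd : ∀ p, f p ≤ C)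
    (hf_int : ∫ p, f p ∂(μ.prod ν) = 1)
    (fX : X → ℝ) (hfX : ∀ x, fX x = ∫ y, f (x, y) ∂ν)
    (M : ℝ) (hM : ∀ p : X × Y, f p ≤ M * fX p.1)
    (ε : ℝ) (hε : 0 < ε) :
    ∃ (K : ℕ) (A : Fin K → Set X) (h : Fin K → Y → ℝ),
      (∀ i, MeasurableSet (A i)) ∧
      (Pairwise fun i j => Disjoint (A i) (A j)) ∧
      (⋃ i, A i) = Set.univ ∧
      (∀ i, Measurable (h i)) ∧
      (∀ i y, 0 < h i y) ∧
      (∀ i, ∫ y, h i y ∂ν = 1) ∧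
      ∫ p in {p : X × Y | 0 < f p},
          f p * Real.log (f p / (fX p.1 * ∑ i, Set.indicator (A i) (fun _ => h i p.2) p.1))
          ∂(μ.prod ν) < ε := by
  have hne : Nonempty (X × Y) := by
    by_contra hcon
    rw [not_nonempty_iff] at hcon
    simp [Measure.eq_zero_of_isEmpty] at hf_int
  obtain ⟨p₀⟩ := hne
  have : Nonempty X := ⟨p₀.1⟩
  have : SecondCountableTopology X := inferInstance
  have : SecondCountableTopology Y := inferInstance
  have hC : 0 ≤ C := (hf_nonneg p₀).trans (hf_bdd p₀)
  have hν : 0 < ν.real Set.univ := by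
    rcases (measureReal_nonneg (μ := ν) (s := Set.univ)).eq_or_lt with h | h
    · have h' : ν = 0 := by
        rw [← Measure.measure_univ_eq_zero]
        exact (measureReal_eq_zero_iff).1 h.symm
      simp [h'] at hf_int
    · exact h
  set N := ν.real Set.univ with hN
  set T := (μ.prod ν).real Set.univ with hT
  have hT0 : 0 ≤ T := measureReal_nonneg
  have hfX0 : ∀ x, 0 ≤ fX x := fun x => by
    rw [hfX]; exact integral_nonneg fun y => hf_nonneg _
  have hfi : Integrable f (μ.prod ν) :=
    Integrable.of_bound hf_meas.aestronglyMeasurable C (ae_of_all _ fun p => by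
      rw [Real.norm_eq_abs, abs_of_nonneg (hf_nonneg p)]; exact hf_bdd p)
  have hfXm : Measurable fX := by
    have : fX = fun x => ∫ y, f (x, y) ∂ν := funext hfX
    rw [this]
    exact hf_meas.stronglyMeasurable.integral_prod_right'.measurable
  have hsec : ∀ x, Integrable (fun y => f (x, y)) ν := fun x =>
    Integrable.of_bound (hf_meas.comp measurable_prodMk_left).aestronglyMeasurable C
      (ae_of_all _ fun p => by
        rw [Real.norm_eq_abs, abs_of_nonneg (hf_nonneg _)]; exact hf_bdd _)
  have hfXC : ∀ x, fX x ≤ C * N := fun x => by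
    rw [hfX]
    calc _ ≤ ∫ y, C ∂ν := integral_mono (hsec x) (integrable_const C) fun y => hf_bdd _
      _ = C * N := by rw [integral_const, smul_eq_mul, mul_comm]
  let g : X × Y → ℝ := fun p => f p / fX p.1
  have hg0 : ∀ p, 0 ≤ g p := fun p => div_nonneg (hf_nonneg p) (hfX0 _)
  have hgm : Measurable g := hf_meas.div (hfXm.comp measurable_fst)
  have hgM : ∀ p, g p ≤ |M| := fun p =>
    div_le_of_le_mul₀ (hfX0 _) (abs_nonneg _)
      ((hM p).trans (mul_le_mul_of_nonneg_right (le_abs_self M) (hfX0 _)))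
  have hgi : Integrable g (μ.prod ν) :=
    Integrable.of_bound hgm.aestronglyMeasurable |M| (ae_of_all _ fun p => by
      rw [Real.norm_eq_abs, abs_of_nonneg (hg0 p)]; exact hgM p)
  have hfg : ∀ p, f p = fX p.1 * g p := fun p => by
    rcases (hfX0 p.1).eq_or_lt with h | h
    · have := hM p
      rw [← h] at this
      rw [← h, zero_mul]
      exact le_antisymm (by simpa using this) (hf_nonneg p)
    · simp only [g]; field_simp
  -- parameters
  set δ := ε / (4 * (C * N * T + 1)) with hδd
  have hδ : 0 < δ := by positivity
  set η := ε / (4 * (C / δ + C * N + 1)) with hηd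
  have hη : 0 < η := by positivity
  obtain ⟨K, ι, c, ψ, hι, hψc, hψ0, hψη⟩ := aux_approx μ ν g hgi hg0 η hη
  obtain ⟨B, hB⟩ := isCompact_univ.exists_bound_of_continuousOn hψc.continuousOn
  let k : X × Y → ℝ := fun p => ψ (c (ι p.1), p.2)
  have hkm : Measurable k := by
    refine hψc.measurable.comp ?_
    exact ((measurable_of_countable c).comp (hι.comp measurable_fst)).prodMk measurable_snd
  have hkB : ∀ p, ‖k p‖ ≤ B := fun p => hB _ (Set.mem_univ _)
  have hki : Integrable k (μ.prod ν) :=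
    Integrable.of_bound hkm.aestronglyMeasurable B (ae_of_all _ hkB)
  have hψs : ∀ x, Integrable (fun y => ψ (x, y) + δ) ν := fun x =>
    (Integrable.of_bound (hψc.measurable.comp measurable_prodMk_left).aestronglyMeasurable B
      (ae_of_all _ fun y => hB _ (Set.mem_univ _))).add (integrable_const δ)
  let Z : Fin K → ℝ := fun i => ∫ y, (ψ (c i, y) + δ) ∂ν
  have hZ : ∀ i, 0 < Z i := fun i => by
    have : ∫ y, δ ∂ν ≤ Z i := integral_mono (integrable_const δ) (hψs _) fun y => by
      have := hψ0 (c i, y)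
      simp only; linarith
    rw [integral_const, smul_eq_mul] at this
    exact (mul_pos hν hδ).trans_le this
  refine ⟨K, fun i => ι ⁻¹' {i}, fun i y => (ψ (c i, y) + δ) / Z i, ?_, ?_, ?_, ?_, ?_, ?_, ?_⟩
  · exact fun i => hι (measurableSet_singleton i)
  · intro i j hij
    exact Disjoint.preimage _ (by simpa using hij)
  · ext x; simp
  · intro i
    exact ((hψc.measurable.comp measurable_prodMk_left).add_const δ).div_const _
  · intro i y
    exact div_pos (add_pos_of_nonneg_of_pos (hψ0 _) hδ) (hZ i)
  · intro i
    rw [integral_div]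
    exact div_self (hZ i).ne'
  have hsum : ∀ p : X × Y, ∑ i, Set.indicator (ι ⁻¹' {i})
      (fun _ => (ψ (c i, p.2) + δ) / Z i) p.1 = (k p + δ) / Z (ι p.1) := by
    intro p
    rw [Finset.sum_eq_single (ι p.1)]
    · simp [k]
    · intro i _ hi
      simp [Ne.symm hi]
    · simp
  simp only [hsum]
  by_cases hint : IntegrableOn (fun p : X × Y => f p * Real.log (f p / (fX p.1 *
      ((k p + δ) / Z (ι p.1))))) {p : X × Y | 0 < f p} (μ.prod ν)
  swap
  · rw [integral_undef hint]; exact hε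
  have hS : MeasurableSet {p : X × Y | 0 < f p} := measurableSet_lt measurable_const hf_meas
  have hZm : Measurable fun p : X × Y => Z (ι p.1) :=
    (measurable_of_countable Z).comp (hι.comp measurable_fst)
  have hgk : Integrable (fun p => |g p - k p|) (μ.prod ν) := (hgi.sub hki).abs
  have hfb : ∀ᵐ p ∂(μ.prod ν), ‖f p‖ ≤ C := ae_of_all _ fun p => by
    rw [Real.norm_eq_abs, abs_of_nonneg (hf_nonneg p)]; exact hf_bdd p
  have hI1 : Integrable (fun p => f p * (|g p - k p| / δ)) (μ.prod ν) :=
    (hgk.div_const δ).bdd_mul hf_meas.aestronglyMeasurable hfb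
  have hZb : ∀ i, ‖Z i‖ ≤ ∑ j, ‖Z j‖ := fun i =>
    Finset.single_le_sum (f := fun j => ‖Z j‖) (fun j _ => norm_nonneg _) (Finset.mem_univ i)
  have hZi : Integrable (fun p : X × Y => Z (ι p.1)) (μ.prod ν) :=
    Integrable.of_bound hZm.aestronglyMeasurable (∑ j, ‖Z j‖) (ae_of_all _ fun p => hZb _)
  have hfZ : Integrable (fun p : X × Y => f p * Z (ι p.1)) (μ.prod ν) :=
    hZi.bdd_mul hf_meas.aestronglyMeasurable hfb
  have hI2 : Integrable (fun p : X × Y => f p * (Z (ι p.1) - 1)) (μ.prod ν) := by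
    simp only [mul_sub, mul_one]
    exact hfZ.sub hfi
  have hkδ : Integrable (fun p : X × Y => fX p.1 * (k p + δ)) (μ.prod ν) :=
    (hki.add (integrable_const δ)).bdd_mul (hfXm.comp measurable_fst).aestronglyMeasurable
      (c := C * N) (ae_of_all _ fun p => by
        rw [Real.norm_eq_abs, abs_of_nonneg (hfX0 _)]; exact hfXC _)
  have hfub : ∫ p, f p * Z (ι p.1) ∂(μ.prod ν) = ∫ p, fX p.1 * (k p + δ) ∂(μ.prod ν) := by
    rw [integral_prod _ hfZ, integral_prod _ hkδ]
    congr 1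
    ext x
    simp only
    rw [integral_mul_const, integral_const_mul, ← hfX]
  have hb2 : ∫ p, f p * (Z (ι p.1) - 1) ∂(μ.prod ν) ≤ C * N * (η + T * δ) := by
    have e1 : ∫ p, f p * (Z (ι p.1) - 1) ∂(μ.prod ν)
        = ∫ p, (fX p.1 * (k p + δ) - f p) ∂(μ.prod ν) := by
      rw [integral_sub hkδ hfi, ← hfub, ← integral_sub hfZ hfi]
      simp only [mul_sub, mul_one]
    rw [e1]
    calc _ ≤ ∫ p, C * N * (|g p - k p| + δ) ∂(μ.prod ν) := by
          refine integral_mono (hkδ.sub hfi) ((hgk.add (integrable_const δ)).const_mul _) ?_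
          intro p
          simp only
          have e2 : fX p.1 * (k p + δ) - f p = fX p.1 * (k p - g p + δ) := by
            conv_lhs => rw [hfg p]
            ring
          rw [e2]
          have e3 : k p - g p + δ ≤ |g p - k p| + δ := by
            linarith [neg_le_abs (g p - k p)]
          calc _ ≤ fX p.1 * (|g p - k p| + δ) := mul_le_mul_of_nonneg_left e3 (hfX0 _)
            _ ≤ _ := mul_le_mul_of_nonneg_right (hfXC _) (by positivity)
      _ = C * N * ((∫ p, |g p - k p| ∂(μ.prod ν)) + T * δ) := by
          rw [integral_const_mul, integral_add hgk (integrable_const δ), integral_const,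
            smul_eq_mul]
      _ ≤ _ := by gcongr
  have hb1 : ∫ p, f p * (|g p - k p| / δ) ∂(μ.prod ν) ≤ C / δ * η := by
    calc _ ≤ ∫ p, C / δ * |g p - k p| ∂(μ.prod ν) := by
          refine integral_mono hI1 (hgk.const_mul _) ?_
          intro p
          simp only
          calc _ ≤ C * (|g p - k p| / δ) :=
                mul_le_mul_of_nonneg_right (hf_bdd p) (by positivity)
            _ = _ := by ring
      _ = C / δ * ∫ p, |g p - k p| ∂(μ.prod ν) := integral_const_mul _ _
      _ ≤ _ := by gcongr
  have hI : Integrable (fun p : X × Y => f p * (|g p - k p| / δ + (Z (ι p.1) - 1)))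
      (μ.prod ν) := by
    simp only [mul_add]
    exact hI1.add hI2
  calc _ ≤ ∫ p in {p : X × Y | 0 < f p}, f p * (|g p - k p| / δ + (Z (ι p.1) - 1))
          ∂(μ.prod ν) := by
        refine setIntegral_mono_on hint hI.integrableOn hS ?_
        intro p hp
        have hp' : 0 < f p := hp
        have hFp : 0 < fX p.1 := by
          rcases (hfX0 p.1).eq_or_lt with h | h
          · have := hfg p
            rw [← h, zero_mul] at this
            exact absurd this hp'.ne'
          · exact h
        exact aux_ptwise _ _ _ _ _ hp' hFp (hψ0 _) hδ (hZ _)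
    _ = ∫ p, f p * (|g p - k p| / δ + (Z (ι p.1) - 1)) ∂(μ.prod ν) := by
        refine setIntegral_eq_integral_of_forall_compl_eq_zero fun p hp => ?_
        have : f p = 0 := le_antisymm (not_lt.1 hp) (hf_nonneg p)
        rw [this, zero_mul]
    _ = (∫ p, f p * (|g p - k p| / δ) ∂(μ.prod ν))
        + ∫ p, f p * (Z (ι p.1) - 1) ∂(μ.prod ν) := by
        rw [← integral_add hI1 hI2]
        simp only [mul_add]
    _ ≤ C / δ * η + C * N * (η + T * δ) := add_le_add hb1 hb2
    _ = (C / δ + C * N) * η + C * N * T * δ := by ring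
    _ ≤ ε / 4 + ε / 4 := by
        have a1 : (C / δ + C * N + 1) * η = ε / 4 := by
          rw [hηd]; field_simp
        have a2 : (C * N * T + 1) * δ = ε / 4 := by
          rw [hδd]; field_simp
        linarith
    _ < ε := by linarith
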